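/- arXiv:1510.00701 — 2 statements merged into one kernel-verified Lean document; each statement's English description precedes it below -/
import Mathlib

section
/- For every τ > 0 and all x, y ∈ ℝ, the Kullback–Leibler divergence between the Laplace measures Laplace(x,τ) and Laplace(y,τ) satisfies K(Laplace(x,τ), Laplace(y,τ)) ≤ (τ²/2)·(x−y)². -/
open MeasureTheory ProbabilityTheory
open scoped ENNReal NNReal

noncomputable section

instance {α : Type*} [MeasurableSpace α] : MeasurableSpace (Option α) :=
  MeasurableSpace.comap (fun o => (Option.elim o (Sum.inr ()) Sum.inl : α ⊕ Unit)) inferInstance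

open Classical in
/-- The Kullback–Leibler divergence `K(P,Q) = ∫ log (dP/dQ) dP` when `P ≪ Q` (and the
log-likelihood ratio is integrable), and `+∞` otherwise. -/
def klDiv {α : Type*} [MeasurableSpace α] (P Q : Measure α) : ℝ≥0∞ :=
  if P ≪ Q ∧ Integrable (fun x => Real.log ((P.rnDeriv Q x).toReal)) P
  then ENNReal.ofReal (∫ x, Real.log ((P.rnDeriv Q x).toReal) ∂P)
  else ⊤

/-- The Laplace measure on `ℝ` centered at `x` with parameter `τ`, having density
`z ↦ (τ/2) exp (−τ|z−x|)` with respect to Lebesgue measure. -/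
def laplaceMeasure (x τ : ℝ) : Measure ℝ :=
  volume.withDensity fun z => ENNReal.ofReal (τ / 2 * Real.exp (-(τ * |z - x|)))

theorem integrable_exp_neg_mul_abs {τ : ℝ} (hτ : 0 < τ) :
    Integrable fun u : ℝ => Real.exp (-(τ * |u|)) := by
  rw [← integrableOn_univ, ← Set.Iic_union_Ioi (a := (0 : ℝ))]
  refine IntegrableOn.union ?_ ?_
  · refine (integrableOn_exp_mul_Iic hτ 0).congr_fun (fun u hu => ?_) measurableSet_Iic
    simp [abs_of_nonpos (Set.mem_Iic.1 hu)]
  · refine (exp_neg_integrableOn_Ioi 0 hτ).congr_fun (fun u hu => ?_) measurableSet_Ioi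
    simp [abs_of_pos (Set.mem_Ioi.1 hu)]

theorem integrable_laplace_density {τ : ℝ} (hτ : 0 < τ) (x : ℝ) :
    Integrable fun z : ℝ => τ / 2 * Real.exp (-(τ * |z - x|)) :=
  ((integrable_exp_neg_mul_abs hτ).comp_sub_right x).const_mul (τ / 2)

theorem isFiniteMeasure_laplaceMeasure {τ : ℝ} (hτ : 0 < τ) (x : ℝ) :
    IsFiniteMeasure (laplaceMeasure x τ) :=
  isFiniteMeasure_withDensity_ofReal (integrable_laplace_density hτ x).2

theorem laplaceMeasure_eq_withDensity {τ : ℝ} (hτ : 0 < τ) (x y : ℝ) :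
    laplaceMeasure x τ = (laplaceMeasure y τ).withDensity
      fun z => ENNReal.ofReal (Real.exp (τ * (|z - y| - |z - x|))) := by
  unfold laplaceMeasure
  rw [← withDensity_mul _ (by fun_prop) (by fun_prop)]
  congr 1
  funext z
  rw [Pi.mul_apply, ← ENNReal.ofReal_mul (by positivity), mul_assoc, ← Real.exp_add]
  ring_nf

theorem log_rnDeriv_laplaceMeasure {τ : ℝ} (hτ : 0 < τ) (x y : ℝ) :
    (fun z => Real.log (((laplaceMeasure x τ).rnDeriv (laplaceMeasure y τ) z).toReal))
      =ᵐ[laplaceMeasure x τ] fun z => τ * (|z - y| - |z - x|) := by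
  have := isFiniteMeasure_laplaceMeasure hτ y
  have hxy := laplaceMeasure_eq_withDensity hτ x y
  have hac : laplaceMeasure x τ ≪ laplaceMeasure y τ := by
    rw [hxy]
    exact withDensity_absolutelyContinuous _ _
  have h := Measure.rnDeriv_withDensity (laplaceMeasure y τ)
    (f := fun z => ENNReal.ofReal (Real.exp (τ * (|z - y| - |z - x|)))) (by fun_prop)
  rw [← hxy] at h
  filter_upwards [hac.ae_le h] with z hz
  rw [hz, ENNReal.toReal_ofReal (Real.exp_nonneg _), Real.log_exp]

theorem abs_add_add_abs_sub_eq (u a : ℝ) :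
    |u + a| + |u - a| - 2 * |u| = 2 * max (|a| - |u|) 0 := by
  rcases abs_cases u with ⟨h1, _⟩ | ⟨h1, _⟩ <;> rcases abs_cases a with ⟨h2, _⟩ | ⟨h2, _⟩ <;>
    rcases abs_cases (u + a) with ⟨h3, _⟩ | ⟨h3, _⟩ <;>
    rcases abs_cases (u - a) with ⟨h4, _⟩ | ⟨h4, _⟩ <;>
    rcases max_cases (|a| - |u|) 0 with ⟨h5, _⟩ | ⟨h5, _⟩ <;> linarith

theorem integrable_max_sub_abs (c : ℝ) : Integrable fun u : ℝ => max (c - |u|) 0 := by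
  refine Continuous.integrable_of_hasCompactSupport (by fun_prop) ?_
  refine HasCompactSupport.intro (isCompact_Icc (a := -c) (b := c)) fun u hu => ?_
  refine max_eq_right ?_
  by_contra! h
  exact hu (abs_le.1 (by linarith))

theorem integral_max_sub_abs {c : ℝ} (hc : 0 ≤ c) : ∫ u : ℝ, max (c - |u|) 0 = c ^ 2 := by
  have hsub : ∀ u ∈ Set.Ioi (0 : ℝ) \ Set.Ioc 0 c, max (c - u) 0 = 0 := by
    intro u hu
    refine max_eq_right ?_
    by_contra! h
    exact hu.2 ⟨hu.1, by linarith⟩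
  have heq : ∫ u in (0 : ℝ)..c, max (c - u) 0 = ∫ u in (0 : ℝ)..c, (c - u) := by
    refine intervalIntegral.integral_congr fun u hu => max_eq_left ?_
    rw [Set.uIcc_of_le hc] at hu
    linarith [hu.2]
  rw [integral_comp_abs (f := fun u => max (c - u) 0),
    setIntegral_eq_of_subset_of_forall_sdiff_eq_zero measurableSet_Ioi
      (fun u hu => hu.1) hsub,
    ← intervalIntegral.integral_of_le hc, heq, intervalIntegral.integral_sub (by simp) (by simp)]
  simp
  ring

theorem abs_mul_abs_sub_abs_le {τ : ℝ} (hτ : 0 < τ) (x y z : ℝ) :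
    |τ * (|z - y| - |z - x|)| ≤ τ * |x - y| := by
  rw [abs_mul, abs_of_pos hτ]
  refine mul_le_mul_of_nonneg_left ((abs_abs_sub_abs_le _ _).trans_eq ?_) hτ.le
  ring_nf

theorem integral_laplace_le {τ : ℝ} (hτ : 0 < τ) (a : ℝ) :
    ∫ u : ℝ, τ / 2 * Real.exp (-(τ * |u|)) * (τ * (|u + a| - |u|)) ≤ τ ^ 2 / 2 * a ^ 2 := by
  set f : ℝ → ℝ := fun u => τ / 2 * Real.exp (-(τ * |u|)) * (τ * (|u + a| - |u|)) with hf
  have hint : Integrable f := by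
    refine Integrable.mul_bdd (c := τ * |a|)
      ((integrable_exp_neg_mul_abs hτ).const_mul (τ / 2)) (by fun_prop) (ae_of_all _ fun u => ?_)
    simpa using abs_mul_abs_sub_abs_le hτ 0 (-a) u
  have hsum : ∫ u, (f u + f (-u)) = 2 * ∫ u, f u := by
    rw [integral_add hint hint.comp_neg, integral_neg_eq_self f, two_mul]
  have hle : ∫ u, (f u + f (-u)) ≤ ∫ u, τ ^ 2 * max (|a| - |u|) 0 := by
    refine integral_mono (hint.add hint.comp_neg) ((integrable_max_sub_abs _).const_mul _)
      fun u => ?_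
    have hneg : |-u + a| = |u - a| := by rw [← abs_neg]; ring_nf
    have hrw : f u + f (-u) = τ ^ 2 * max (|a| - |u|) 0 * Real.exp (-(τ * |u|)) := by
      simp only [hf, abs_neg, hneg]
      linear_combination τ ^ 2 / 2 * Real.exp (-(τ * |u|)) * abs_add_add_abs_sub_eq u a
    change f u + f (-u) ≤ _
    rw [hrw]
    refine mul_le_of_le_one_right (by positivity) (Real.exp_le_one_iff.2 ?_)
    have : 0 ≤ τ * |u| := by positivity
    linarith
  rw [hsum, integral_const_mul, integral_max_sub_abs (abs_nonneg a), sq_abs] at hle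
  linarith

/-- quadratic upper bound on the KL divergence between Laplace measures. -/
theorem klDiv_laplace_le (τ x y : ℝ) (hτ : 0 < τ) :
    klDiv (laplaceMeasure x τ) (laplaceMeasure y τ) ≤
      ENNReal.ofReal (τ ^ 2 / 2 * (x - y) ^ 2) := by
  have := isFiniteMeasure_laplaceMeasure hτ x
  have hlog := log_rnDeriv_laplaceMeasure hτ x y
  have hac : laplaceMeasure x τ ≪ laplaceMeasure y τ := by
    rw [laplaceMeasure_eq_withDensity hτ x y]
    exact withDensity_absolutelyContinuous _ _
  have hint : Integrable (fun z => τ * (|z - y| - |z - x|)) (laplaceMeasure x τ) :=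
    Integrable.of_bound (by fun_prop) (τ * |x - y|)
      (ae_of_all _ fun z => abs_mul_abs_sub_abs_le hτ x y z)
  rw [klDiv, if_pos ⟨hac, hint.congr hlog.symm⟩, integral_congr_ae hlog]
  refine ENNReal.ofReal_le_ofReal (le_of_eq_of_le ?_ (integral_laplace_le hτ (x - y)))
  rw [laplaceMeasure, integral_withDensity_eq_integral_toReal_smul (by fun_prop) (by simp),
    ← integral_sub_right_eq_self
      (fun u => τ / 2 * Real.exp (-(τ * |u|)) * (τ * (|u + (x - y)| - |u|))) x]
  refine integral_congr_ae (ae_of_all _ fun z => ?_)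
  have hz : z - x + (x - y) = z - y := by ring
  simp only [hz, smul_eq_mul]
  rw [ENNReal.toReal_ofReal (by positivity)]

end
end

section
/- Let n₁, n₂ ≥ 2 and 1 ≤ r ≤ min(n₁,n₂) be integers, let k be an integer with 2n₂ ≤ k ≤ r·n₂ and k − n₂ ≥ 8 and ⌈k/n₂⌉ ≤ r, and let 0 < X_min ≤ A_max and 0 < a₀ ≤ A_max be reals. Set r′ := ⌈k/n₂⌉ − 1. Then there exists a finite set 𝒳⁰ of n₁×n₂ real matrices such that: (i) the constant matrix X₀ with all entries equal to X_min belongs to 𝒳⁰; (ii) |𝒳⁰| ≥ 2^{(k−n₂)/8} + 1; (iii) every X ∈ 𝒳⁰ has all entries in {X_min, X_min + a₀} and belongs to 𝒳′(r,k,A_max,X_min) := { X ∈ 𝒳(r,k,A_max) : X_{i,j} ≥ X_min for all (i,j) }; and (iv) for any two distinct X₁, X₂ ∈ 𝒳⁰, ‖X₁ − X₂‖²_F ≥ ((k−n₂)/8)·⌊n₁/r′⌋·a₀² ≥ (n₁n₂/32)·a₀². -/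
open MeasureTheory ProbabilityTheory
open scoped ENNReal NNReal

noncomputable section

/-- Squared Frobenius norm of a real matrix. -/
def frobSq {n₁ n₂ : ℕ} (X : Matrix (Fin n₁) (Fin n₂) ℝ) : ℝ :=
  ∑ i, ∑ j, (X i j) ^ 2

/-- The sparse-factor model class `𝒳(r,k,A_max)`. -/
def sparseClass (n₁ n₂ r k : ℕ) (Amax : ℝ) : Set (Matrix (Fin n₁) (Fin n₂) ℝ) :=
  {X | ∃ (D : Matrix (Fin n₁) (Fin r) ℝ) (A : Matrix (Fin r) (Fin n₂) ℝ),
    X = D * A ∧ (∀ i j, |D i j| ≤ 1) ∧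
    (Finset.univ.filter fun p : Fin r × Fin n₂ => A p.1 p.2 ≠ 0).card ≤ k ∧
    ∀ i j, |A i j| ≤ Amax}

/-- `Δ(k,n₂) = min{1, k/n₂}`. -/
def Delta (k n₂ : ℕ) : ℝ := min 1 ((k : ℝ) / (n₂ : ℝ))

open Finset in
/-- Chernoff-type bound on the volume of a Hamming ball of radius less than `#S / 8`. -/
lemma card_small_subsets_le {α : Type*} [DecidableEq α] (S : Finset α) :
    (#{t ∈ S.powerset | 8 * #t < #S} : ℝ) ≤ 2 ^ (3 * (#S : ℝ) / 4) := by
  have hexp : (1 / 4 : ℝ) ^ ((#S : ℝ) / 8) = 2 ^ (-((#S : ℝ) / 4)) := by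
    rw [show (1 / 4 : ℝ) = 2 ^ (-2 : ℝ) by
      rw [Real.rpow_neg (by norm_num)]; norm_num, ← Real.rpow_mul (by norm_num)]
    ring_nf
  have hsum : (#{t ∈ S.powerset | 8 * #t < #S} : ℝ) * 2 ^ (-((#S : ℝ) / 4))
      ≤ (5 / 4) ^ #S := by
    calc _ = ∑ t ∈ S.powerset with 8 * #t < #S, (1 / 4 : ℝ) ^ ((#S : ℝ) / 8) := by
          rw [sum_const, nsmul_eq_mul, hexp]
      _ ≤ ∑ t ∈ S.powerset with 8 * #t < #S, (1 / 4 : ℝ) ^ #t * 1 ^ (#S - #t) := by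
          refine sum_le_sum fun t ht ↦ ?_
          have h : (8 * #t : ℝ) < #S := by exact_mod_cast (mem_filter.1 ht).2
          rw [one_pow, mul_one, ← Real.rpow_natCast]
          exact Real.rpow_le_rpow_of_exponent_ge (by norm_num) (by norm_num) (by linarith)
      _ ≤ ∑ t ∈ S.powerset, (1 / 4 : ℝ) ^ #t * 1 ^ (#S - #t) :=
          sum_le_sum_of_subset_of_nonneg (filter_subset _ _) fun _ _ _ ↦ by positivity
      _ = (5 / 4) ^ #S := by rw [sum_pow_mul_eq_add_pow]; norm_num
  have hbase : (5 / 4 : ℝ) ^ #S ≤ 2 ^ ((#S : ℝ) / 2) := by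
    have h : (5 / 4 : ℝ) ≤ 2 ^ (1 / 2 : ℝ) := by
      rw [← Real.sqrt_eq_rpow]
      exact Real.le_sqrt_of_sq_le (by norm_num)
    calc (5 / 4 : ℝ) ^ #S ≤ (2 ^ (1 / 2 : ℝ)) ^ #S := by gcongr
      _ = 2 ^ ((#S : ℝ) / 2) := by
        rw [← Real.rpow_natCast, ← Real.rpow_mul (by norm_num)]; ring_nf
  calc (#{t ∈ S.powerset | 8 * #t < #S} : ℝ)
      = #{t ∈ S.powerset | 8 * #t < #S} * 2 ^ (-((#S : ℝ) / 4)) * 2 ^ ((#S : ℝ) / 4) := by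
        rw [mul_assoc, ← Real.rpow_add (by norm_num)]; simp
    _ ≤ 2 ^ ((#S : ℝ) / 2) * 2 ^ ((#S : ℝ) / 4) := by gcongr; exact hsum.trans hbase
    _ = 2 ^ (3 * (#S : ℝ) / 4) := by rw [← Real.rpow_add (by norm_num)]; ring_nf

open Finset in
/-- A maximal separated family of subsets covers the power set. -/
lemma exists_separated_covering {α : Type*} [DecidableEq α] (S : Finset α) :
    ∃ Ω : Finset (Finset α), Ω ⊆ S.powerset ∧ ∅ ∈ Ω ∧
      (∀ s ∈ Ω, ∀ t ∈ Ω, s ≠ t → #S ≤ 8 * #(symmDiff s t)) ∧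
      ∀ t ∈ S.powerset, t ∈ Ω ∨ ∃ s ∈ Ω, 8 * #(symmDiff s t) < #S := by
  obtain ⟨Ω, hΩ, hmax⟩ := exists_max_image
    {Ω ∈ S.powerset.powerset | ∅ ∈ Ω ∧ ∀ s ∈ Ω, ∀ t ∈ Ω, s ≠ t → #S ≤ 8 * #(symmDiff s t)}
    card ⟨{∅}, by simp⟩
  simp only [mem_filter, mem_powerset (s := Ω)] at hΩ
  obtain ⟨hsub, h0, hsep⟩ := hΩ
  refine ⟨Ω, hsub, h0, hsep, fun t ht ↦ ?_⟩
  by_contra! h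
  obtain ⟨htΩ, hfar⟩ := h
  have := hmax (insert t Ω) (by
    refine mem_filter.2 ⟨mem_powerset.2 (insert_subset ht hsub), mem_insert_of_mem h0, ?_⟩
    intro a ha b hb hab
    rcases mem_insert.1 ha with rfl | haΩ <;> rcases mem_insert.1 hb with rfl | hbΩ
    · exact absurd rfl hab
    · rw [symmDiff_comm]; exact hfar b hbΩ
    · exact hfar a haΩ
    · exact hsep a haΩ b hbΩ hab)
  rw [card_insert_of_notMem htΩ] at this
  omega

open Finset in
/-- The Varshamov–Gilbert bound, for subsets of a finite set. -/
lemma exists_varshamov_gilbert {α : Type*} [DecidableEq α] (S : Finset α) (hS : 8 ≤ #S) :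
    ∃ Ω : Finset (Finset α), Ω ⊆ S.powerset ∧ ∅ ∈ Ω ∧
      (2 : ℝ) ^ ((#S : ℝ) / 8) + 1 ≤ #Ω ∧
      ∀ s ∈ Ω, ∀ t ∈ Ω, s ≠ t → #S ≤ 8 * #(symmDiff s t) := by
  obtain ⟨Ω, hsub, h0, hsep, hcov⟩ := exists_separated_covering S
  refine ⟨Ω, hsub, h0, ?_, hsep⟩
  have hcover : S.powerset ⊆ Ω.biUnion fun s ↦
      {t ∈ S.powerset | 8 * #t < #S}.image (symmDiff s) := by
    intro t ht
    have hnear : ∃ s ∈ Ω, 8 * #(symmDiff s t) < #S := by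
      rcases hcov t ht with h | h
      · exact ⟨t, h, by rw [symmDiff_self, bot_eq_empty, card_empty]; omega⟩
      · exact h
    obtain ⟨s, hs, hst⟩ := hnear
    refine mem_biUnion.2 ⟨s, hs, mem_image.2 ⟨symmDiff s t, mem_filter.2 ⟨?_, hst⟩, ?_⟩⟩
    · exact mem_powerset.2 (symmDiff_le_sup.trans
        (sup_le (mem_powerset.1 (hsub hs)) (mem_powerset.1 ht)))
    · exact symmDiff_symmDiff_cancel_left s t
  have hcard : 2 ^ #S ≤ #Ω * #{t ∈ S.powerset | 8 * #t < #S} := by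
    rw [← card_powerset]
    exact (card_le_card hcover).trans (card_biUnion_le_card_mul _ _ _ fun _ _ ↦ card_image_le)
  have hm : (1 : ℝ) ≤ (#S : ℝ) / 8 := by
    have : (8 : ℝ) ≤ #S := by exact_mod_cast hS
    linarith
  have hΩ : (2 : ℝ) ^ ((#S : ℝ) / 4) ≤ #Ω := by
    refine le_of_mul_le_mul_right ?_ (Real.rpow_pos_of_pos two_pos (3 * (#S : ℝ) / 4))
    calc (2 : ℝ) ^ ((#S : ℝ) / 4) * 2 ^ (3 * (#S : ℝ) / 4) = 2 ^ #S := by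
          rw [← Real.rpow_add (by norm_num), ← Real.rpow_natCast]; ring_nf
      _ ≤ #Ω * #{t ∈ S.powerset | 8 * #t < #S} := by exact_mod_cast hcard
      _ ≤ #Ω * 2 ^ (3 * (#S : ℝ) / 4) := by gcongr; exact card_small_subsets_le S
  have h2 : (2 : ℝ) ≤ 2 ^ ((#S : ℝ) / 8) := by
    simpa using Real.rpow_le_rpow_of_exponent_le (x := 2) (by norm_num) hm
  have hsq : (2 : ℝ) ^ ((#S : ℝ) / 4) = 2 ^ ((#S : ℝ) / 8) * 2 ^ ((#S : ℝ) / 8) := by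
    rw [← Real.rpow_add (by norm_num)]; ring_nf
  nlinarith

/-- The matrix equal to `x + a` on the blocks of `q` consecutive rows indexed by `W`,
and to `x` elsewhere. -/
def blockMatrix (n₁ n₂ q : ℕ) (x a : ℝ) (W : Finset (ℕ × Fin n₂)) :
    Matrix (Fin n₁) (Fin n₂) ℝ :=
  Matrix.of fun i j ↦ x + if ((i : ℕ) / q, j) ∈ W then a else 0

open Finset in
lemma blockMatrix_mem_sparseClass {n₁ n₂ r r' q k : ℕ} {x a Amax : ℝ}
    {W : Finset (ℕ × Fin n₂)} (hr : r' + 1 ≤ r) (hW : ∀ p ∈ W, p.1 < r')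
    (hk : n₂ + #W ≤ k) (hx : |x| ≤ Amax) (ha : |a| ≤ Amax) :
    blockMatrix n₁ n₂ q x a W ∈ sparseClass n₁ n₂ r k Amax := by
  obtain ⟨s, rfl⟩ : ∃ s, r = s + 1 := ⟨r - 1, by omega⟩
  refine ⟨Matrix.of fun i ↦ Fin.cons 1 fun l : Fin s ↦ if (i : ℕ) / q = l then 1 else 0,
    Matrix.of (Fin.cons (fun _ ↦ x) fun l j ↦ if ((l : ℕ), j) ∈ W then a else 0), ?_, ?_, ?_, ?_⟩
  · ext i j
    simp only [blockMatrix, Matrix.mul_apply, Matrix.of_apply, Fin.sum_univ_succ, Fin.cons_zero,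
      Fin.cons_succ, one_mul, ite_mul, zero_mul]
    congr 1
    by_cases h : ((i : ℕ) / q, j) ∈ W
    · have hlt : (i : ℕ) / q < s := by have := hW _ h; simp only at this; omega
      rw [sum_eq_single ⟨_, hlt⟩]
      · simp
      · intro l _ hl
        rw [if_neg fun e ↦ hl (Fin.ext e.symm)]
      · simp
    · rw [if_neg h]
      refine (sum_eq_zero fun l _ ↦ ?_).symm
      split_ifs with h1 h2
      · exact absurd (h1 ▸ h2) h
      · rfl
      · rfl
  · intro i l
    refine Fin.cases ?_ (fun l ↦ ?_) l
    · simp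
    · simp only [Matrix.of_apply, Fin.cons_succ]
      split_ifs <;> simp
  · refine le_trans ?_ hk
    refine le_trans (card_le_card (t := (univ.image fun j ↦ ((0 : Fin (s + 1)), j)) ∪
      W.image fun p ↦ (Fin.ofNat (s + 1) (p.1 + 1), p.2)) ?_) ?_
    · rintro ⟨l, j⟩ h
      rw [mem_filter] at h
      revert h
      refine Fin.cases ?_ (fun l ↦ ?_) l
      · simp
      · simp only [Matrix.of_apply, Fin.cons_succ]
        intro h
        have hl : ((l : ℕ), j) ∈ W := by by_contra hn; simp [hn] at h
        refine mem_union_right _ (mem_image.2 ⟨_, hl, ?_⟩)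
        ext <;> simp
    · refine (card_union_le _ _).trans (add_le_add ?_ card_image_le)
      exact card_image_le.trans (by simp)
  · intro l j
    refine Fin.cases ?_ (fun l ↦ ?_) l
    · simpa using hx
    · simp only [Matrix.of_apply, Fin.cons_succ]
      split_ifs
      · exact ha
      · simpa using (abs_nonneg a).trans ha

open Finset in
lemma mul_card_symmDiff_le_frobSq {n₁ n₂ r' q : ℕ} {x a : ℝ} {W W' : Finset (ℕ × Fin n₂)}
    (hq : r' * q ≤ n₁) (hW : ∀ p ∈ W, p.1 < r') (hW' : ∀ p ∈ W', p.1 < r') :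
    (#(symmDiff W W') : ℝ) * q * a ^ 2 ≤
      frobSq (blockMatrix n₁ n₂ q x a W - blockMatrix n₁ n₂ q x a W') := by
  have hcard : #(symmDiff W W' ×ˢ range q) ≤
      #{p : Fin n₁ × Fin n₂ | ((p.1 : ℕ) / q, p.2) ∈ symmDiff W W'} := by
    refine card_le_card_of_surjOn (fun p ↦ (((p.1 : ℕ) / q, p.2), (p.1 : ℕ) % q)) ?_
    rintro ⟨⟨b, j⟩, t⟩ h
    obtain ⟨hb, ht⟩ := mem_product.1 (mem_coe.1 h)
    have ht : t < q := mem_range.1 ht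
    have hbr : b < r' := by
      rcases mem_symmDiff.1 hb with h | h
      · exact hW _ h.1
      · exact hW' _ h.1
    have hlt : q * b + t < n₁ := by nlinarith
    have hdiv : (q * b + t) / q = b := by
      rw [Nat.mul_add_div (by omega), Nat.div_eq_of_lt ht, add_zero]
    have hmod : (q * b + t) % q = t := by rw [Nat.mul_add_mod, Nat.mod_eq_of_lt ht]
    exact ⟨(⟨q * b + t, hlt⟩, j), by simpa [hdiv] using hb, by simp [hdiv, hmod]⟩
  have hfrob : frobSq (blockMatrix n₁ n₂ q x a W - blockMatrix n₁ n₂ q x a W') =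
      #{p : Fin n₁ × Fin n₂ | ((p.1 : ℕ) / q, p.2) ∈ symmDiff W W'} * a ^ 2 := by
    rw [frobSq, ← Fintype.sum_prod_type', ← nsmul_eq_mul, ← sum_const, sum_filter]
    refine sum_congr rfl fun p _ ↦ ?_
    simp only [blockMatrix, Matrix.sub_apply, Matrix.of_apply, mem_symmDiff]
    split_ifs <;> simp_all
  rw [hfrob]
  refine mul_le_mul_of_nonneg_right ?_ (sq_nonneg a)
  rw [card_product, card_range] at hcard
  exact_mod_cast hcard

/-- existence of the packing set for the Poisson setting, whose elements
have all entries in `{X_min, X_min + a₀}` and lie in the class `𝒳'(r,k,A_max,X_min)`. -/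
theorem packing_set_poisson (n₁ n₂ r k : ℕ) (h₁ : 2 ≤ n₁) (h₂ : 2 ≤ n₂)
    (hr₁ : 1 ≤ r) (hr₂ : r ≤ min n₁ n₂) (hk₁ : 2 * n₂ ≤ k) (hk₂ : k ≤ r * n₂)
    (hk₈ : 8 ≤ k - n₂) (hceil : ⌈(k : ℝ) / (n₂ : ℝ)⌉₊ ≤ r)
    (Xmin Amax a₀ : ℝ) (hXmin : 0 < Xmin) (hXA : Xmin ≤ Amax)
    (ha₀ : 0 < a₀) (ha₀A : a₀ ≤ Amax)
    (r' : ℕ) (hr' : r' = ⌈(k : ℝ) / (n₂ : ℝ)⌉₊ - 1) :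
    ∃ 𝒳 : Finset (Matrix (Fin n₁) (Fin n₂) ℝ),
      (Matrix.of fun _ _ => Xmin) ∈ 𝒳 ∧
      (2 : ℝ) ^ (((k : ℝ) - n₂) / 8) + 1 ≤ (𝒳.card : ℝ) ∧
      (∀ X ∈ 𝒳, (∀ i j, X i j = Xmin ∨ X i j = Xmin + a₀) ∧
        X ∈ {X ∈ sparseClass n₁ n₂ r k Amax | ∀ i j, Xmin ≤ X i j}) ∧
      (∀ X₁ ∈ 𝒳, ∀ X₂ ∈ 𝒳, X₁ ≠ X₂ →
        ((k : ℝ) - n₂) / 8 * ((n₁ / r' : ℕ) : ℝ) * a₀ ^ 2 ≤ frobSq (X₁ - X₂)) ∧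
      (n₁ : ℝ) * n₂ / 32 * a₀ ^ 2 ≤
        ((k : ℝ) - n₂) / 8 * ((n₁ / r' : ℕ) : ℝ) * a₀ ^ 2 := by
  classical
  have hn₂ : (0 : ℝ) < n₂ := by exact_mod_cast (by omega : 0 < n₂)
  have hceil2 : 2 ≤ ⌈(k : ℝ) / n₂⌉₊ := by
    have h : (2 : ℝ) ≤ ⌈(k : ℝ) / n₂⌉₊ := by
      refine le_trans ?_ (Nat.le_ceil _)
      rw [le_div_iff₀ hn₂]
      exact_mod_cast hk₁
    exact_mod_cast h
  have hrr : r' + 1 = ⌈(k : ℝ) / n₂⌉₊ := by omega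
  have hr'_pos : 0 < r' := by omega
  have hle : k ≤ (r' + 1) * n₂ := by
    have h := Nat.le_ceil ((k : ℝ) / n₂)
    rw [← hrr, div_le_iff₀ hn₂] at h
    exact_mod_cast h
  have hlt : r' * n₂ < k := by
    have h : (r' : ℝ) < k / n₂ := Nat.lt_ceil.1 (by omega)
    rw [lt_div_iff₀ hn₂] at h
    exact_mod_cast h
  have hr'n : r' ≤ n₁ := by
    have := min_le_left n₁ n₂
    omega
  set q := n₁ / r' with hq
  have hq_pos : 0 < q := Nat.div_pos hr'n hr'_pos
  have hqn : r' * q ≤ n₁ := Nat.mul_div_le n₁ r'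
  have hnq : n₁ ≤ 2 * (r' * q) := by
    have h := Nat.div_add_mod n₁ r'
    have h' := Nat.mod_lt n₁ hr'_pos
    rw [← hq] at h
    nlinarith
  have hsub : ((k - n₂ : ℕ) : ℝ) = (k : ℝ) - n₂ := Nat.cast_sub (by omega)
  obtain ⟨S, hS, hScard⟩ := Finset.exists_subset_card_eq
    (s := Finset.range r' ×ˢ (Finset.univ : Finset (Fin n₂))) (n := k - n₂) (by
      rw [Finset.card_product, Finset.card_range, Finset.card_univ, Fintype.card_fin]
      rw [add_mul] at hle
      omega)
  obtain ⟨Ω, hΩS, h0, hΩcard, hsep⟩ := exists_varshamov_gilbert S (hScard ▸ hk₈)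
  rw [hScard, hsub] at hΩcard
  have hrow : ∀ W ∈ Ω, ∀ p ∈ W, p.1 < r' := fun W hW p hp ↦
    Finset.mem_range.1 (Finset.mem_product.1 (hS (Finset.mem_powerset.1 (hΩS hW) hp))).1
  have hfrob : ∀ W ∈ Ω, ∀ W' ∈ Ω, W ≠ W' →
      ((k : ℝ) - n₂) / 8 * (q : ℝ) * a₀ ^ 2 ≤
        frobSq (blockMatrix n₁ n₂ q Xmin a₀ W - blockMatrix n₁ n₂ q Xmin a₀ W') := by
    intro W hW W' hW' hne
    refine le_trans ?_ (mul_card_symmDiff_le_frobSq hqn (hrow W hW) (hrow W' hW'))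
    have h : ((k - n₂ : ℕ) : ℝ) ≤ 8 * (symmDiff W W').card := by
      exact_mod_cast hScard ▸ hsep W hW W' hW' hne
    rw [hsub] at h
    gcongr
    linarith
  have hk₈' : (8 : ℝ) ≤ (k : ℝ) - n₂ := by rw [← hsub]; exact_mod_cast hk₈
  have hinj : Set.InjOn (blockMatrix n₁ n₂ q Xmin a₀) Ω := by
    intro W hW W' hW' heq
    by_contra hne
    have h := hfrob W hW W' hW' hne
    rw [heq, sub_self] at h
    have hz : frobSq (0 : Matrix (Fin n₁) (Fin n₂) ℝ) = 0 := by simp [frobSq]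
    have hp : 0 < ((k : ℝ) - n₂) / 8 * (q : ℝ) * a₀ ^ 2 := by
      have : (0 : ℝ) < q := by exact_mod_cast hq_pos
      have : 0 < ((k : ℝ) - n₂) / 8 := by linarith
      positivity
    linarith
  refine ⟨Ω.image (blockMatrix n₁ n₂ q Xmin a₀), ?_, ?_, ?_, ?_, ?_⟩
  · refine Finset.mem_image.2 ⟨∅, h0, ?_⟩
    ext i j
    simp [blockMatrix]
  · rwa [Finset.card_image_of_injOn hinj]
  · intro X hX
    obtain ⟨W, hW, rfl⟩ := Finset.mem_image.1 hX
    have hentry : ∀ i j, blockMatrix n₁ n₂ q Xmin a₀ W i j = Xmin ∨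
        blockMatrix n₁ n₂ q Xmin a₀ W i j = Xmin + a₀ := by
      intro i j
      simp only [blockMatrix, Matrix.of_apply]
      split_ifs <;> simp
    refine ⟨hentry, blockMatrix_mem_sparseClass (hrr ▸ hceil) (hrow W hW) ?_ ?_ ?_, fun i j ↦ ?_⟩
    · have := Finset.card_le_card (Finset.mem_powerset.1 (hΩS hW))
      omega
    · rwa [abs_of_pos hXmin]
    · rwa [abs_of_pos ha₀]
    · rcases hentry i j with h | h <;> rw [h]
      linarith
  · intro X₁ hX₁ X₂ hX₂ hne
    obtain ⟨W, hW, rfl⟩ := Finset.mem_image.1 hX₁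
    obtain ⟨W', hW', rfl⟩ := Finset.mem_image.1 hX₂
    exact hfrob W hW W' hW' fun h ↦ hne (h ▸ rfl)
  · refine mul_le_mul_of_nonneg_right ?_ (sq_nonneg a₀)
    have hA : (n₁ : ℝ) ≤ 2 * (r' * q) := by exact_mod_cast hnq
    have hB : (r' : ℝ) * n₂ ≤ 2 * (k - n₂) := by
      have h1 : (r' : ℝ) * n₂ ≤ k := by exact_mod_cast hlt.le
      have h2 : 2 * (n₂ : ℝ) ≤ k := by exact_mod_cast hk₁
      linarith
    have hA' := mul_le_mul_of_nonneg_right hA hn₂.le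
    have hB' := mul_le_mul_of_nonneg_right hB (Nat.cast_nonneg (α := ℝ) q)
    linarith

end
end
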